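/- Suppose V = V₀ ⊕ V₁ ⊕ ⋯ ⊕ V_n is a direct sum of G-invariant subspaces and G is generated by subgroups G₁, …, G_n such that: G acts trivially on V₀; for each i, the subgroup G_i acts trivially on V_j for every j ≠ i; and for each i and each k with 1 ≤ k ≤ dim V_i, the subspace of G_i-invariant vectors in the exterior power ⋀^k V_i is zero. Then for every m ≥ 0, the dimension of the G-invariant subspace of ⋀^m V equals the binomial coefficient C(dim V₀, m). (By Frobenius reciprocity this computes the multiplicity ⟨Ind_G^W 1, ⋀^m V⟩ when G is a subgroup of a larger group W acting on V.) -/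

import Mathlib

/-- An endomorphism of `M` maps the `k`-th exterior power of `M` (inside the
exterior algebra) into itself. -/
theorem extPow_map_mem {R M : Type*} [CommRing R] [AddCommGroup M] [Module R M]
    (k : ℕ) (f : M →ₗ[R] M) :
    ∀ x ∈ ⋀[R]^k M, ExteriorAlgebra.map f x ∈ ⋀[R]^k M := by
  have hbase : Submodule.map (ExteriorAlgebra.map f).toLinearMap
      (LinearMap.range (ExteriorAlgebra.ι R (M := M)))
      ≤ LinearMap.range (ExteriorAlgebra.ι R (M := M)) := by
    rw [ExteriorAlgebra.ι_range_map_map]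
    rintro x hx
    obtain ⟨y, -, rfl⟩ := hx
    exact ⟨y, rfl⟩
  have h : Submodule.map (ExteriorAlgebra.map f).toLinearMap (⋀[R]^k M) ≤ ⋀[R]^k M := by
    rw [show (⋀[R]^k M)
        = LinearMap.range (ExteriorAlgebra.ι R (M := M)) ^ k from rfl,
      Submodule.map_pow]
    exact pow_le_pow_left' hbase k
  intro x hx
  exact h ⟨x, hx, rfl⟩

/-- The linear map induced by `f : M →ₗ[R] M` on the `k`-th exterior power. -/
noncomputable def extPowMap {R M : Type*} [CommRing R] [AddCommGroup M] [Module R M]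
    (k : ℕ) (f : M →ₗ[R] M) : (⋀[R]^k M) →ₗ[R] (⋀[R]^k M) :=
  (ExteriorAlgebra.map f).toLinearMap.restrict (extPow_map_mem k f)

open Module

section ExteriorAlgebra

variable {R M N P : Type*} [CommRing R] [AddCommGroup M] [Module R M] [AddCommGroup N] [Module R N]
  [AddCommGroup P] [Module R P]

theorem ExteriorAlgebra.map_map_apply (f : M →ₗ[R] N) (g : N →ₗ[R] P) (x : ExteriorAlgebra R M) :
    map g (map f x) = map (g ∘ₗ f) x := by
  rw [← map_comp_map, AlgHom.comp_apply]

theorem ExteriorAlgebra.map_zero_apply (x : ExteriorAlgebra R M) :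
    map (0 : M →ₗ[R] N) x = algebraMap R _ (algebraMapInv x) := by
  have : map (0 : M →ₗ[R] N) =
      (Algebra.ofId R (ExteriorAlgebra R N)).comp (algebraMapInv (R := R) (M := M)) := by
    ext v
    simp [algebraMapInv]
  rw [this]
  rfl

theorem ExteriorAlgebra.ι_mul_eq_map_neg_mul_ι (w : M) (x : ExteriorAlgebra R M) :
    ι R w * x = map (-LinearMap.id) x * ι R w := by
  induction x using ExteriorAlgebra.induction with
  | algebraMap r => rw [AlgHom.commutes, Algebra.commutes]
  | ι v =>
    have h := ExteriorAlgebra.ι_add_mul_swap (R := R) w v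
    simp only [map_apply_ι, LinearMap.neg_apply, LinearMap.id_apply, map_neg, neg_mul]
    exact eq_neg_of_add_eq_zero_left h
  | mul a b ha hb => rw [map_mul, ← mul_assoc, ha, mul_assoc, hb, mul_assoc]
  | add a b ha hb => rw [map_add, mul_add, add_mul, ha, hb]

/-- If `M` and `N` jointly span `P`, then `⋀ P` is spanned by products of elements of `⋀ M`
with elements of `⋀ N`. -/
theorem ExteriorAlgebra.span_map_mul_map_eq_top (j : M →ₗ[R] P) (l : N →ₗ[R] P)
    (hjl : ∀ v, ∃ a b, v = j a + l b) :
    Submodule.span R (Set.range fun p : ExteriorAlgebra R M × ExteriorAlgebra R N =>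
      map j p.1 * map l p.2) = ⊤ := by
  set S := Submodule.span R (Set.range fun p : ExteriorAlgebra R M × ExteriorAlgebra R N =>
      map j p.1 * map l p.2)
  have mem (a : ExteriorAlgebra R M) (b : ExteriorAlgebra R N) : map j a * map l b ∈ S :=
    Submodule.subset_span ⟨(a, b), rfl⟩
  have key (x : ExteriorAlgebra R P) : ∀ y ∈ S, x * y ∈ S := by
    induction x using ExteriorAlgebra.induction with
    | algebraMap r =>
      intro y hy
      rw [← Algebra.smul_def]
      exact S.smul_mem r hy
    | mul a b ha hb =>
      intro y hy
      rw [mul_assoc]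
      exact ha _ (hb _ hy)
    | add a b ha hb =>
      intro y hy
      rw [add_mul]
      exact S.add_mem (ha _ hy) (hb _ hy)
    | ι v =>
      intro y hy
      induction hy using Submodule.span_induction with
      | zero => simp
      | add y z _ _ hy hz =>
        rw [mul_add]
        exact S.add_mem hy hz
      | smul r y _ hy =>
        rw [mul_smul_comm]
        exact S.smul_mem r hy
      | mem y hy =>
        obtain ⟨⟨a, b⟩, rfl⟩ := hy
        obtain ⟨c, d, rfl⟩ := hjl v
        rw [map_add, add_mul]
        refine S.add_mem ?_ ?_
        · have := mem (ι R c * a) b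
          rwa [map_mul, map_apply_ι, mul_assoc] at this
        · have := mem (map (-LinearMap.id) a) (ι R d * b)
          rw [map_mul, map_apply_ι, ← mul_assoc] at this
          rw [← mul_assoc, ι_mul_eq_map_neg_mul_ι]
          convert this using 3
          rw [map_map_apply, map_map_apply]
          congr 2
          ext
          simp
  refine eq_top_iff.2 fun x _ => ?_
  simpa using key x 1 (by simpa using mem 1 1)

theorem exteriorPower.coe_map (k : ℕ) (f : M →ₗ[R] N) (x : ⋀[R]^k M) :
    (exteriorPower.map k f x : ExteriorAlgebra R N) = ExteriorAlgebra.map f x := by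
  have : (⋀[R]^k N).subtype ∘ₗ exteriorPower.map k f =
      (ExteriorAlgebra.map f).toLinearMap ∘ₗ (⋀[R]^k M).subtype := by
    ext v
    simp [ExteriorAlgebra.map_apply_ιMulti]
  exact LinearMap.congr_fun this x

@[simp]
theorem extPowMap_coe (k : ℕ) (f : M →ₗ[R] M) (x : ⋀[R]^k M) :
    (extPowMap k f x : ExteriorAlgebra R M) = ExteriorAlgebra.map f x :=
  rfl

theorem mem_iInf_ker_extPowMap_sub_id {H : Type*} (k : ℕ) (σ : H → M →ₗ[R] M) (x : ⋀[R]^k M) :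
    x ∈ ⨅ h, LinearMap.ker (extPowMap k (σ h) - LinearMap.id) ↔
      ∀ h, ExteriorAlgebra.map (σ h) (x : ExteriorAlgebra R M) = x := by
  simp [Submodule.mem_iInf, sub_eq_zero, Subtype.ext_iff]

/-- If no positive exterior power of `M` has nonzero invariants, the sum of the group action
on `⋀ M` is a multiple of the projection onto scalars. -/
theorem ExteriorAlgebra.sum_map_eq_card_smul {H : Type*} [Group H] [Fintype H]
    (σ : H → M →ₗ[R] M) (hmul : ∀ g h, σ (g * h) = σ g ∘ₗ σ h)
    (hσ : ∀ k, 1 ≤ k → (⨅ h, LinearMap.ker (extPowMap k (σ h) - LinearMap.id)) = ⊥)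
    (x : ExteriorAlgebra R M) :
    ∑ h, map (σ h) x = Fintype.card H • algebraMap R _ (algebraMapInv x) := by
  classical
  induction x using DirectSum.Decomposition.inductionOn (fun k : ℕ => ⋀[R]^k M) with
  | zero => simp
  | add a b ha hb => simp only [map_add, Finset.sum_add_distrib, ha, hb, smul_add]
  | @homogeneous k x =>
    rcases Nat.eq_zero_or_pos k with rfl | hk
    · obtain ⟨x, hx⟩ := x
      have hx' : x ∈ LinearMap.range (ι R (M := M)) ^ 0 := hx
      rw [pow_zero] at hx'
      obtain ⟨r, rfl⟩ := Submodule.mem_one.1 hx'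
      simp [algebraMapInv]
    · have hinv : ∑ h, extPowMap k (σ h) x = 0 := by
        rw [← Submodule.mem_bot R, ← hσ k hk, mem_iInf_ker_extPowMap_sub_id]
        intro g
        simp only [AddSubmonoidClass.coe_finsetSum, extPowMap_coe, map_sum, map_map_apply, ← hmul]
        exact Fintype.sum_equiv (Equiv.mulLeft g) _ _ fun _ => rfl
      have hzero : map (0 : M →ₗ[R] M) (x : ExteriorAlgebra R M) = 0 := by
        have h0 : exteriorPower.map k (0 : M →ₗ[R] M) = 0 := by
          ext v
          have : Nonempty (Fin k) := ⟨⟨0, hk⟩⟩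
          simp only [LinearMap.compAlternatingMap_apply, exteriorPower.map_apply_ιMulti]
          rw [show (⇑(0 : M →ₗ[R] M) ∘ v) = 0 from rfl, AlternatingMap.map_zero]
          simp
        rw [← exteriorPower.coe_map, h0]
        rfl
      rw [map_zero_apply] at hzero
      rw [hzero, smul_zero]
      simpa using congrArg Subtype.val hinv

/-- Let `P = j(M) ⊕ l(P)` with `l` a projection, and let a finite group act trivially on `l(P)` and
without invariants on the positive exterior powers of `M`. Then the sum of the group action on
`⋀ P` is a multiple of the map induced by `l`. -/
theorem ExteriorAlgebra.sum_map_eq_card_smul_map {H : Type*} [Group H] [Fintype H]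
    (σ : H → M →ₗ[R] M) (hmul : ∀ g h, σ (g * h) = σ g ∘ₗ σ h)
    (hσ : ∀ k, 1 ≤ k → (⨅ h, LinearMap.ker (extPowMap k (σ h) - LinearMap.id)) = ⊥)
    (τ : H → P →ₗ[R] P) (j : M →ₗ[R] P) (l : P →ₗ[R] P)
    (hjl : ∀ v, ∃ a b, v = j a + l b) (hτj : ∀ h, τ h ∘ₗ j = j ∘ₗ σ h) (hτl : ∀ h, τ h ∘ₗ l = l)
    (hlj : l ∘ₗ j = 0) (hll : l ∘ₗ l = l) (x : ExteriorAlgebra R P) :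
    ∑ h, map (τ h) x = Fintype.card H • map l x := by
  have hx : x ∈ Submodule.span R (Set.range
      fun p : ExteriorAlgebra R M × ExteriorAlgebra R P => map j p.1 * map l p.2) := by
    rw [span_map_mul_map_eq_top j l hjl]
    trivial
  induction hx using Submodule.span_induction with
  | zero => simp
  | add y z _ _ hy hz => simp only [map_add, Finset.sum_add_distrib, hy, hz, smul_add]
  | smul r y _ hy => simp only [map_smul, ← Finset.smul_sum, hy, smul_comm r]
  | mem y hy =>
    obtain ⟨⟨a, b⟩, rfl⟩ := hy
    simp only [map_mul, map_map_apply, hτj, hτl, hlj, hll, map_zero_apply]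
    rw [← Finset.sum_mul]
    simp only [← map_map_apply (σ _) j]
    rw [← map_sum, sum_map_eq_card_smul σ hmul hσ, map_nsmul, AlgHom.commutes, smul_mul_assoc]

end ExteriorAlgebra

theorem exteriorPower.subsingleton_of_finrank_lt {K M : Type*} [Field K] [AddCommGroup M]
    [Module K M] [FiniteDimensional K M] {k : ℕ} (hk : finrank K M < k) :
    Subsingleton (⋀[K]^k M) := by
  rw [← Module.finrank_zero_iff (R := K), exteriorPower.finrank_eq, Nat.choose_eq_zero_of_lt hk]

/-- For an internal direct sum, there is a projection killing the `i`-th summand and fixing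
all the others. -/
theorem DirectSum.IsInternal.exists_projection {R V ι : Type*} [CommRing R] [AddCommGroup V]
    [Module R V] [DecidableEq ι] {A : ι → Submodule R V} (hA : DirectSum.IsInternal A) (i : ι) :
    ∃ l : V →ₗ[R] V, (∀ v ∈ A i, l v = 0) ∧ (∀ j ≠ i, ∀ v ∈ A j, l v = v) ∧
      ∀ v, v - l v ∈ A i := by
  let e := LinearEquiv.ofBijective (DirectSum.coeLinearMap A) hA
  let p : V →ₗ[R] A i := DirectSum.component R ι (fun i => A i) i ∘ₗ e.symm.toLinearMap
  have he (j : ι) (v : A j) : e.symm v = DirectSum.lof R ι (fun i => A i) j v := by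
    rw [LinearEquiv.symm_apply_eq]
    exact (DirectSum.coeLinearMap_lof A j v).symm
  refine ⟨LinearMap.id - (A i).subtype ∘ₗ p, fun v hv => ?_, fun j hj v hv => ?_, fun v => ?_⟩
  · have := he i ⟨v, hv⟩
    simp only at this
    simp [p, this, DirectSum.component.lof_self]
  · have := he j ⟨v, hv⟩
    simp only at this
    simp [p, this, DirectSum.component.of, hj]
  · simp

theorem LinearMap.eq_of_eqOn_iSup_eq_top {R V W ι : Type*} [CommRing R] [AddCommGroup V]
    [Module R V] [AddCommGroup W] [Module R W] {A : ι → Submodule R V} (hA : iSup A = ⊤)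
    {f g : V →ₗ[R] W} (h : ∀ i, ∀ v ∈ A i, f v = g v) : f = g := by
  rw [← LinearMap.eqLocus_eq_top, eq_top_iff, ← hA]
  exact iSup_le fun i v hv => h i v hv

/-- Suppose `V = V₀ ⊕ V₁ ⊕ ⋯ ⊕ V_n` as `G`-invariant subspaces,
`G` is generated by subgroups `G₁, …, G_n`, `G` acts trivially on `V₀`, each `G_i`
acts trivially on `V_j` for `j ≠ i`, and for `1 ≤ k ≤ dim V_i` the `G_i`-invariants
of `⋀^k V_i` vanish.  Then for every `m`, the dimension of the `G`-invariants of
`⋀^m V` equals the binomial coefficient `C(dim V₀, m)`. -/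
theorem invariants_of_exteriorPower_dim
    {G : Type*} [Group G] [Finite G]
    {V : Type*} [AddCommGroup V] [Module ℂ V] [FiniteDimensional ℂ V]
    (ρ : Representation ℂ G V)
    (n : ℕ) (Vsub : Fin (n + 1) → Submodule ℂ V)
    (hinv : ∀ (i : Fin (n + 1)) (g : G), ∀ x ∈ Vsub i, ρ g x ∈ Vsub i)
    (hsum : DirectSum.IsInternal Vsub)
    (Gsub : Fin n → Subgroup G)
    (hgen : (⨆ i, Gsub i) = ⊤)
    (htriv₀ : ∀ (g : G), ∀ x ∈ Vsub 0, ρ g x = x)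
    (htriv : ∀ (i : Fin n), ∀ g ∈ Gsub i, ∀ (j : Fin (n + 1)), j ≠ i.succ →
      ∀ x ∈ Vsub j, ρ g x = x)
    (hext : ∀ (i : Fin n) (k : ℕ), 1 ≤ k → k ≤ Module.finrank ℂ (Vsub i.succ) →
      (⨅ g : Gsub i, LinearMap.ker
        (extPowMap k ((ρ (g : G)).restrict (hinv i.succ (g : G))) - LinearMap.id)) = ⊥)
    (m : ℕ) :
    Module.finrank ℂ
        ↥(⨅ g : G, LinearMap.ker (extPowMap m (ρ g) - LinearMap.id))
      = (Module.finrank ℂ (Vsub 0)).choose m := by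
  have htop := hsum.submodule_iSup_eq_top
  choose l hl_zero hl_id hl_mem using fun i : Fin n => hsum.exists_projection i.succ
  have hl_map (i : Fin n) (x : ExteriorAlgebra ℂ V)
      (hx : ∀ g, ExteriorAlgebra.map (ρ g) x = x) : ExteriorAlgebra.map (l i) x = x := by
    have := Fintype.ofFinite (Gsub i)
    have hvanish (k : ℕ) (hk : 1 ≤ k) : (⨅ g : Gsub i, LinearMap.ker
        (extPowMap k ((ρ (g : G)).restrict (hinv i.succ (g : G))) - LinearMap.id)) = ⊥ := by
      rcases le_or_gt k (finrank ℂ (Vsub i.succ)) with h | h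
      · exact hext i k hk h
      · have := exteriorPower.subsingleton_of_finrank_lt h
        exact Subsingleton.elim _ _
    have key := ExteriorAlgebra.sum_map_eq_card_smul_map
      (fun g : Gsub i => (ρ (g : G)).restrict (hinv i.succ (g : G)))
      (fun g h => by ext; simp) hvanish (fun g : Gsub i => ρ g) (Vsub i.succ).subtype (l i)
      (fun v => ⟨⟨v - l i v, hl_mem i v⟩, v, by simp⟩) (fun g => by ext; simp)
      (fun g => LinearMap.eq_of_eqOn_iSup_eq_top htop fun j v hv => by
        rcases eq_or_ne j i.succ with rfl | hj
        · simp [hl_zero i v hv]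
        · simp [hl_id i j hj v hv, htriv i g g.2 j hj v hv])
      (by ext v; simp [hl_zero i v v.2])
      (LinearMap.eq_of_eqOn_iSup_eq_top htop fun j v hv => by
        rcases eq_or_ne j i.succ with rfl | hj
        · simp [hl_zero i v hv]
        · simp [hl_id i j hj v hv]) x
    simp only [hx, Finset.sum_const, Finset.card_univ,
      ← Nat.cast_smul_eq_nsmul ℂ] at key
    exact (smul_right_injective _ (Nat.cast_ne_zero.2 Fintype.card_ne_zero) key).symm
  have hproj (x : ExteriorAlgebra ℂ V) (hx : ∀ g, ExteriorAlgebra.map (ρ g) x = x)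
      (s : Finset (Fin n)) : ∃ f : V →ₗ[ℂ] V, ExteriorAlgebra.map f x = x ∧
        (∀ i ∈ s, ∀ v ∈ Vsub i.succ, f v = 0) ∧ ∀ j, ∀ v ∈ Vsub j, f v ∈ Vsub j := by
    induction s using Finset.induction with
    | empty => exact ⟨LinearMap.id, by simp, by simp, by simp⟩
    | insert i s _ ih =>
      obtain ⟨f, hfx, hf_zero, hf_mem⟩ := ih
      refine ⟨l i ∘ₗ f, ?_, fun k hk v hv => ?_, fun j v hv => ?_⟩
      · rw [← ExteriorAlgebra.map_map_apply, hfx, hl_map i x hx]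
      · rcases Finset.mem_insert.1 hk with rfl | hk
        · exact hl_zero k _ (hf_mem _ v hv)
        · simp [hf_zero k hk v hv]
      · have hfv := hf_mem j v hv
        rcases eq_or_ne j i.succ with rfl | hj
        · simp [hl_zero i _ hfv]
        · simpa [hl_id i j hj _ hfv] using hfv
  have hrange : (⨅ g : G, LinearMap.ker (extPowMap m (ρ g) - LinearMap.id)) =
      LinearMap.range (exteriorPower.map m (Vsub 0).subtype) := by
    ext x
    rw [mem_iInf_ker_extPowMap_sub_id]
    constructor
    · intro hx
      obtain ⟨f, hfx, hf_zero, hf_mem⟩ := hproj x hx Finset.univ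
      have hf (v : V) : f v ∈ Vsub 0 := by
        have hle : (⊤ : Submodule ℂ V) ≤ (Vsub 0).comap f := by
          rw [← htop]
          refine iSup_le fun j v hv => ?_
          cases j using Fin.cases with
          | zero => exact hf_mem 0 v hv
          | succ i => simp [hf_zero i (Finset.mem_univ i) v hv]
        exact hle (Submodule.mem_top (x := v))
      refine ⟨exteriorPower.map m (f.codRestrict (Vsub 0) hf) x, Subtype.ext ?_⟩
      rw [exteriorPower.coe_map, exteriorPower.coe_map, ExteriorAlgebra.map_map_apply,
        LinearMap.subtype_comp_codRestrict, hfx]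
    · rintro ⟨y, rfl⟩ g
      rw [exteriorPower.coe_map, ExteriorAlgebra.map_map_apply]
      congr 2
      ext v
      exact htriv₀ g v v.2
  rw [hrange, LinearMap.finrank_range_of_inj
    (exteriorPower.map_injective_field (Vsub 0).subtype_injective), exteriorPower.finrank_eq]
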